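/- (Gradient for the ambiguity functional) Let W ∈ ℝ^{n×n} be symmetric, ℰ a symmetric set of index pairs, and ε > 0. Let E : ℝ → ℝ^{n×n} be differentiable with E(t) symmetric and P_ℰ(E(t)) = E(t) for all t, and let λ₂, λ₃ : ℝ → ℝ and x, y : ℝ → ℝⁿ be differentiable with Lap(W + εE(t)) x(t) = λ₂(t) x(t), Lap(W + εE(t)) y(t) = λ₃(t) y(t), and ‖x(t)‖₂ = ‖y(t)‖₂ = 1 for all t. Then d/dt (λ₃(t) − λ₂(t)) = ε ⟨G, Ė(t)⟩, where G = P_ℰ( sym(y² 𝟙ᵀ) − y yᵀ − sym(x² 𝟙ᵀ) + x xᵀ ) with x = x(t), y = y(t); G is symmetric with sparsity pattern ℰ. -/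

import Mathlib

open Matrix BigOperators

/-- The graph Laplacian `Lap(Z) = diag(Z 𝟙) - Z`. -/
noncomputable def Lap {n : ℕ} (Z : Matrix (Fin n) (Fin n) ℝ) : Matrix (Fin n) (Fin n) ℝ :=
  Matrix.diagonal (Z.mulVec fun _ => (1 : ℝ)) - Z

/-- The Frobenius inner product `⟨X, Y⟩ = trace(Xᵀ Y)`. -/
noncomputable def finner {n : ℕ} (X Y : Matrix (Fin n) (Fin n) ℝ) : ℝ :=
  (Xᵀ * Y).trace

/-- The entrywise projection onto the sparsity pattern `S`. -/
noncomputable def proj {n : ℕ} (S : Set (Fin n × Fin n)) (A : Matrix (Fin n) (Fin n) ℝ) :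
    Matrix (Fin n) (Fin n) ℝ :=
  Matrix.of fun i j => S.indicator (fun p => A p.1 p.2) (i, j)

/-- The symmetric part `sym(A) = (A + Aᵀ)/2`. -/
noncomputable def symPart {n : ℕ} (A : Matrix (Fin n) (Fin n) ℝ) : Matrix (Fin n) (Fin n) ℝ :=
  (2 : ℝ)⁻¹ • (A + Aᵀ)

/-- **Hellmann–Feynman formula**: along a path of matrices which is symmetric at `t`, the derivative
of an eigenvalue with unit eigenvector is the quadratic form of the derivative of the path at it. -/
theorem eigenvalue_deriv_eq_dotProduct {ι : Type*} [Fintype ι] {A : ℝ → Matrix ι ι ℝ}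
    {A' : Matrix ι ι ℝ} {lam : ℝ → ℝ} {lam' : ℝ} {v : ℝ → ι → ℝ} {v' : ι → ℝ} {t : ℝ}
    (hsymm : (A t).IsSymm) (hA : ∀ i j, HasDerivAt (fun s => A s i j) (A' i j) t)
    (hlam : HasDerivAt lam lam' t) (hv : ∀ i, HasDerivAt (fun s => v s i) (v' i) t)
    (heig : ∀ s, A s *ᵥ v s = lam s • v s) (hunit : ∑ i, v t i ^ 2 = 1) :
    lam' = v t ⬝ᵥ A' *ᵥ v t := by
  have hderiv : A' *ᵥ v t + A t *ᵥ v' = lam' • v t + lam t • v' := by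
    ext i
    have hleft : HasDerivAt (fun s => ∑ j, A s i j * v s j)
        (∑ j, (A' i j * v t j + A t i j * v' j)) t :=
      HasDerivAt.fun_sum fun j _ => (hA i j).fun_mul (hv j)
    have hfun : (fun s => ∑ j, A s i j * v s j) = fun s => lam s * v s i :=
      funext fun s => congrFun (heig s) i
    rw [hfun] at hleft
    have huniq := hleft.unique (hlam.fun_mul (hv i))
    rw [Finset.sum_add_distrib] at huniq
    exact huniq
  have hnorm : v t ⬝ᵥ v t = 1 := by
    simpa only [dotProduct, ← sq] using hunit
  have hself : v t ⬝ᵥ A t *ᵥ v' = lam t * (v t ⬝ᵥ v') := by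
    rw [dotProduct_mulVec, ← mulVec_transpose, hsymm.eq, heig, smul_dotProduct, smul_eq_mul]
  have hdot := congrArg (v t ⬝ᵥ ·) hderiv
  simp only [dotProduct_add, dotProduct_smul, smul_eq_mul, hnorm, hself] at hdot
  linarith

theorem lap_apply {n : ℕ} (Z : Matrix (Fin n) (Fin n) ℝ) (i j : Fin n) :
    Lap Z i j = (if i = j then ∑ k, Z i k else 0) - Z i j := by
  simp [Lap, diagonal_apply, mulVec, dotProduct]

theorem isSymm_lap {n : ℕ} {Z : Matrix (Fin n) (Fin n) ℝ} (hZ : Z.IsSymm) : (Lap Z).IsSymm :=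
  (isSymm_diagonal _).sub hZ

theorem hasDerivAt_lap_apply {n : ℕ} {Z : ℝ → Matrix (Fin n) (Fin n) ℝ}
    {Z' : Matrix (Fin n) (Fin n) ℝ} {t : ℝ}
    (hZ : ∀ i j, HasDerivAt (fun s => Z s i j) (Z' i j) t) (i j : Fin n) :
    HasDerivAt (fun s => Lap (Z s) i j) (Lap Z' i j) t := by
  simp only [lap_apply]
  refine HasDerivAt.fun_sub ?_ (hZ i j)
  split_ifs
  · exact HasDerivAt.fun_sum fun k _ => hZ i k
  · exact hasDerivAt_const t 0

theorem finner_eq_sum {n : ℕ} (X Y : Matrix (Fin n) (Fin n) ℝ) :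
    finner X Y = ∑ i, ∑ j, X i j * Y i j := by
  rw [Finset.sum_comm]
  simp [finner, trace, mul_apply]

theorem finner_add_left {n : ℕ} (X Y Z : Matrix (Fin n) (Fin n) ℝ) :
    finner (X + Y) Z = finner X Z + finner Y Z := by
  simp [finner, add_mul]

theorem finner_sub_left {n : ℕ} (X Y Z : Matrix (Fin n) (Fin n) ℝ) :
    finner (X - Y) Z = finner X Z - finner Y Z := by
  simp [finner, sub_mul]

theorem finner_smul_right {n : ℕ} (c : ℝ) (X Y : Matrix (Fin n) (Fin n) ℝ) :
    finner X (c • Y) = c * finner X Y := by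
  simp [finner]

theorem finner_symPart_left {n : ℕ} (X : Matrix (Fin n) (Fin n) ℝ)
    {Z : Matrix (Fin n) (Fin n) ℝ} (hZ : Z.IsSymm) : finner (symPart X) Z = finner X Z := by
  have htranspose : finner Xᵀ Z = finner X Z := by
    simp only [finner_eq_sum, transpose_apply]
    rw [Finset.sum_comm]
    simp only [hZ.apply]
  have hsymPart : finner (symPart X) Z = (2 : ℝ)⁻¹ * (finner X Z + finner Xᵀ Z) := by
    simp [finner, symPart, add_mul, mul_add]
  rw [hsymPart, htranspose]
  ring

theorem finner_proj_left {n : ℕ} (S : Set (Fin n × Fin n)) (X Z : Matrix (Fin n) (Fin n) ℝ) :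
    finner (proj S X) Z = finner X (proj S Z) := by
  classical
  simp [finner_eq_sum, proj, Set.indicator_apply]

theorem proj_proj {n : ℕ} (S : Set (Fin n × Fin n)) (X : Matrix (Fin n) (Fin n) ℝ) :
    proj S (proj S X) = proj S X := by
  classical
  ext i j
  simp +contextual [proj, Set.indicator_apply]

theorem isSymm_proj {n : ℕ} {S : Set (Fin n × Fin n)} (hS : ∀ i j, (i, j) ∈ S → (j, i) ∈ S)
    {X : Matrix (Fin n) (Fin n) ℝ} (hX : X.IsSymm) : (proj S X).IsSymm := by
  classical
  refine IsSymm.ext fun i j => ?_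
  simp only [proj, of_apply, Set.indicator_apply, hX.apply]
  exact if_congr ⟨hS j i, hS i j⟩ rfl rfl

theorem isSymm_symPart {n : ℕ} (X : Matrix (Fin n) (Fin n) ℝ) : (symPart X).IsSymm :=
  (isSymm_add_transpose_self X).smul _

theorem isSymm_vecMulVec_self {n : ℕ} (v : Fin n → ℝ) : (vecMulVec v v).IsSymm :=
  transpose_vecMulVec v v

theorem dotProduct_lap_mulVec {n : ℕ} {Z : Matrix (Fin n) (Fin n) ℝ} (hZ : Z.IsSymm)
    (v : Fin n → ℝ) :
    v ⬝ᵥ Lap Z *ᵥ v =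
      finner (symPart (vecMulVec (fun i => v i ^ 2) fun _ => (1 : ℝ)) - vecMulVec v v) Z := by
  rw [finner_sub_left, finner_symPart_left _ hZ, Lap, sub_mulVec, dotProduct_sub]
  simp only [finner_eq_sum, vecMulVec_apply, dotProduct, mulVec_diagonal]
  simp only [mulVec, dotProduct, Finset.mul_sum, Finset.sum_mul, mul_one]
  congr 1 <;> exact Finset.sum_congr rfl fun i _ => Finset.sum_congr rfl fun j _ => by ring

theorem isSymm_of_hasDerivAt {ι : Type*} {Z : ℝ → Matrix ι ι ℝ} {Z' : Matrix ι ι ℝ} {t : ℝ}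
    (hsymm : ∀ s, (Z s).IsSymm) (hZ : ∀ i j, HasDerivAt (fun s => Z s i j) (Z' i j) t) :
    Z'.IsSymm := by
  refine IsSymm.ext fun i j => (hZ j i).unique ?_
  simpa only [(hsymm _).apply] using hZ i j

theorem proj_eq_of_hasDerivAt {n : ℕ} {S : Set (Fin n × Fin n)}
    {Z : ℝ → Matrix (Fin n) (Fin n) ℝ} {Z' : Matrix (Fin n) (Fin n) ℝ} {t : ℝ}
    (hproj : ∀ s, proj S (Z s) = Z s) (hZ : ∀ i j, HasDerivAt (fun s => Z s i j) (Z' i j) t) :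
    proj S Z' = Z' := by
  classical
  ext i j
  by_cases hij : (i, j) ∈ S
  · simp [proj, hij]
  · have hzero : (fun s => Z s i j) = fun _ => (0 : ℝ) := by
      funext s
      rw [← hproj s]
      simp [proj, hij]
    have hderiv := hZ i j
    rw [hzero] at hderiv
    simpa [proj, hij] using (hasDerivAt_const t (0 : ℝ)).unique hderiv

/-- The derivative of an eigenvalue of `Lap(W + ε E(t))` with unit eigenvector `v`. -/
theorem lap_eigenvalue_deriv {n : ℕ} {W : Matrix (Fin n) (Fin n) ℝ} (hW : W.IsSymm) (ε : ℝ)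
    {Z : ℝ → Matrix (Fin n) (Fin n) ℝ} {Z' : Matrix (Fin n) (Fin n) ℝ}
    {lam : ℝ → ℝ} {lam' : ℝ} {v : ℝ → Fin n → ℝ} {v' : Fin n → ℝ} {t : ℝ}
    (hsymm : ∀ s, (Z s).IsSymm) (hZ : ∀ i j, HasDerivAt (fun s => Z s i j) (Z' i j) t)
    (hlam : HasDerivAt lam lam' t) (hv : ∀ i, HasDerivAt (fun s => v s i) (v' i) t)
    (heig : ∀ s, Lap (W + ε • Z s) *ᵥ v s = lam s • v s) (hunit : ∑ i, v t i ^ 2 = 1) :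
    lam' = ε * finner
      (symPart (vecMulVec (fun i => v t i ^ 2) fun _ => (1 : ℝ)) - vecMulVec (v t) (v t)) Z' := by
  have hpath (i j : Fin n) : HasDerivAt (fun s => (W + ε • Z s) i j) ((ε • Z') i j) t :=
    ((hZ i j).const_mul ε).const_add (W i j)
  rw [eigenvalue_deriv_eq_dotProduct (isSymm_lap (hW.add ((hsymm t).smul ε)))
      (hasDerivAt_lap_apply hpath) hlam hv heig hunit,
    dotProduct_lap_mulVec ((isSymm_of_hasDerivAt hsymm hZ).smul ε), finner_smul_right]

/-- **gradient for the ambiguity functional.** Along a differentiable path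
`E(t)` of symmetric matrices with sparsity pattern `ℰ`, if `λ₂(t), λ₃(t)` are differentiable
eigenvalues of `Lap(W + ε E(t))` with differentiable unit eigenvectors `x(t), y(t)`, then
`d/dt (λ₃ - λ₂) = ε ⟨G, Ė⟩` with `G = P_ℰ(sym(y² 𝟙ᵀ) - y yᵀ - sym(x² 𝟙ᵀ) + x xᵀ)`;
`G` is symmetric with sparsity pattern `ℰ`. -/
theorem ambiguity_functional_gradient {n : ℕ}
    (W : Matrix (Fin n) (Fin n) ℝ) (hW : W.IsSymm)
    (E : Set (Fin n × Fin n)) (hEsymset : ∀ i j, (i, j) ∈ E → (j, i) ∈ E)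
    (ε : ℝ) (hε : 0 < ε)
    (Epath E' : ℝ → Matrix (Fin n) (Fin n) ℝ)
    (hEsym : ∀ t, (Epath t).IsSymm)
    (hEsp : ∀ t, proj E (Epath t) = Epath t)
    (hE' : ∀ t i j, HasDerivAt (fun s => Epath s i j) (E' t i j) t)
    (lam2 lam2' lam3 lam3' : ℝ → ℝ) (x x' y y' : ℝ → Fin n → ℝ)
    (hlam2 : ∀ t, HasDerivAt lam2 (lam2' t) t)
    (hlam3 : ∀ t, HasDerivAt lam3 (lam3' t) t)
    (hx : ∀ t i, HasDerivAt (fun s => x s i) (x' t i) t)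
    (hy : ∀ t i, HasDerivAt (fun s => y s i) (y' t i) t)
    (heig2 : ∀ t, (Lap (W + ε • Epath t)).mulVec (x t) = lam2 t • x t)
    (heig3 : ∀ t, (Lap (W + ε • Epath t)).mulVec (y t) = lam3 t • y t)
    (hxnorm : ∀ t, ∑ i, x t i ^ 2 = 1)
    (hynorm : ∀ t, ∑ i, y t i ^ 2 = 1) :
    ∀ t,
      lam3' t - lam2' t =
        ε * finner (proj E
          (symPart (vecMulVec (fun i => y t i ^ 2) fun _ => (1 : ℝ)) -
            vecMulVec (y t) (y t) -
            symPart (vecMulVec (fun i => x t i ^ 2) fun _ => (1 : ℝ)) +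
            vecMulVec (x t) (x t))) (E' t) ∧
      (proj E
          (symPart (vecMulVec (fun i => y t i ^ 2) fun _ => (1 : ℝ)) -
            vecMulVec (y t) (y t) -
            symPart (vecMulVec (fun i => x t i ^ 2) fun _ => (1 : ℝ)) +
            vecMulVec (x t) (x t))).IsSymm ∧
      proj E (proj E
          (symPart (vecMulVec (fun i => y t i ^ 2) fun _ => (1 : ℝ)) -
            vecMulVec (y t) (y t) -
            symPart (vecMulVec (fun i => x t i ^ 2) fun _ => (1 : ℝ)) +
            vecMulVec (x t) (x t))) =
        proj E
          (symPart (vecMulVec (fun i => y t i ^ 2) fun _ => (1 : ℝ)) -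
            vecMulVec (y t) (y t) -
            symPart (vecMulVec (fun i => x t i ^ 2) fun _ => (1 : ℝ)) +
            vecMulVec (x t) (x t)) := by
  intro t
  refine ⟨?_, isSymm_proj hEsymset ?_, proj_proj _ _⟩
  · rw [finner_proj_left, proj_eq_of_hasDerivAt hEsp (hE' t),
      lap_eigenvalue_deriv hW ε hEsym (hE' t) (hlam3 t) (hy t) heig3 (hynorm t),
      lap_eigenvalue_deriv hW ε hEsym (hE' t) (hlam2 t) (hx t) heig2 (hxnorm t)]
    simp only [finner_add_left, finner_sub_left]
    ring
  · exact (((isSymm_symPart _).sub (isSymm_vecMulVec_self _)).sub (isSymm_symPart _)).add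
      (isSymm_vecMulVec_self _)
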